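/- Let g be a finite-dimensional Lie algebra over a field of characteristic zero and let h be a Lie subalgebra of g that is a subideal of g (there is a finite chain h = l₀ ⊴ l₁ ⊴ ⋯ ⊴ lₙ = g of subalgebras, each an ideal of the next). Let r_h denote the radical of h, viewed as a subspace of g. Then the following are equivalent: (i) h is an ideal of g (⁅g, h⁆ ⊆ h); (ii) r_h is an ideal of g (⁅g, r_h⁆ ⊆ r_h); (iii) ⁅r_h, g⁆ ⊆ h. -/

import Mathlib

/-- `a` is an ideal of `b` (for Lie subalgebras `a ≤ b` of `g`). -/
def LieSubalgebra.IsIdealOf {K : Type*} [Field K] {g : Type*} [LieRing g] [LieAlgebra K g]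
    (a b : LieSubalgebra K g) : Prop :=
  a ≤ b ∧ ∀ x ∈ b, ∀ y ∈ a, ⁅x, y⁆ ∈ a

namespace LieAlgebra

variable {K : Type*} [Field K] {L : Type*} [LieRing L] [LieAlgebra K L]

/-- The quotient map by a Lie ideal, as a homomorphism of Lie algebras. -/
def quotientHom (I : LieIdeal K L) : L →ₗ⁅K⁆ L ⧸ I :=
  { (LieSubmodule.Quotient.mk' I : L →ₗ[K] L ⧸ I) with
    map_lie' := fun {x y} ↦ LieSubmodule.Quotient.mk_bracket I x y }

theorem quotientHom_surjective (I : LieIdeal K L) : Function.Surjective (quotientHom I) :=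
  LieSubmodule.Quotient.surjective_mk' I

@[simp]
theorem quotientHom_ker (I : LieIdeal K L) : (quotientHom I).ker = I := by
  ext x
  exact LieHom.mem_ker.trans LieSubmodule.Quotient.mk_eq_zero'

theorem derivedSeriesOfIdeal_comap_le {L' : Type*} [LieRing L'] [LieAlgebra K L']
    (f : L →ₗ⁅K⁆ L') (J : LieIdeal K L') (k : ℕ) :
    derivedSeriesOfIdeal K L k (J.comap f) ≤ (derivedSeriesOfIdeal K L' k J).comap f := by
  induction k with
  | zero => exact le_rfl
  | succ k ih =>
    simp only [derivedSeriesOfIdeal_succ]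
    exact (LieSubmodule.mono_lie ih ih).trans (LieIdeal.comap_bracket_le f)

/-- Solvability is stable under extensions: the preimage of a solvable ideal under a homomorphism
with solvable kernel is solvable. -/
theorem isSolvable_comap {L' : Type*} [LieRing L'] [LieAlgebra K L'] (f : L →ₗ⁅K⁆ L')
    [IsSolvable f.ker] (J : LieIdeal K L') [IsSolvable J] : IsSolvable (J.comap f) := by
  obtain ⟨k, hk⟩ := IsSolvable.solvable K J
  obtain ⟨l, hl⟩ := IsSolvable.solvable K f.ker
  rw [LieIdeal.derivedSeries_eq_bot_iff] at hk hl
  refine IsSolvable.mk (R := K) (k := l + k) ?_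
  rw [LieIdeal.derivedSeries_eq_bot_iff, derivedSeriesOfIdeal_add, eq_bot_iff, ← hl]
  refine derivedSeriesOfIdeal_mono ((derivedSeriesOfIdeal_comap_le f J k).trans ?_) l
  intro x hx
  rwa [LieIdeal.mem_comap, hk, LieSubmodule.mem_bot, ← LieHom.mem_ker] at hx

variable [FiniteDimensional K L]

instance hasTrivialRadical_quotient_radical : HasTrivialRadical K (L ⧸ radical K L) := by
  refine hasTrivialRadical_of_no_solvable_ideals fun J hJ ↦ ?_
  have : IsSolvable (quotientHom (radical K L)).ker := by
    rw [quotientHom_ker]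
    infer_instance
  have hle := (LieIdeal.solvable_iff_le_radical K L _).mp
    (isSolvable_comap (quotientHom (radical K L)) J)
  rw [eq_bot_iff]
  intro q hq
  obtain ⟨x, rfl⟩ := quotientHom_surjective _ q
  rw [LieSubmodule.mem_bot, ← LieHom.mem_ker, quotientHom_ker]
  exact hle (LieIdeal.mem_comap.mpr hq)

variable [CharZero K]

theorem derivedSeries_one_eq_top_of_hasTrivialRadical [HasTrivialRadical K L] :
    derivedSeries K L 1 = ⊤ := by
  set I := derivedSeries K L 1
  have hc := I.isCompl_killingCompl
  have : IsLieAbelian I.killingCompl := by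
    rw [LieSubmodule.lie_abelian_iff_lie_self_eq_bot, eq_bot_iff, ← hc.inf_eq_bot]
    exact le_inf (LieSubmodule.mono_lie le_top le_top) (LieSubmodule.lie_le_left _ _)
  have hbot := IsKilling.ideal_eq_bot_of_isLieAbelian I.killingCompl
  simpa [hbot] using hc.sup_eq_top

variable (K L) in
theorem derivedSeries_one_sup_radical : derivedSeries K L 1 ⊔ radical K L = ⊤ := by
  have hs := quotientHom_surjective (radical K L)
  have hmap : (derivedSeries K L 1).map (quotientHom (radical K L)) = ⊤ := by
    rw [LieIdeal.derivedSeries_map_eq 1 hs]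
    exact derivedSeries_one_eq_top_of_hasTrivialRadical
  have hcomap := LieIdeal.comap_map_eq (f := quotientHom (radical K L))
    (I := derivedSeries K L 1) (congrArg SetLike.coe (LieIdeal.coe_map_of_surjective hs))
  rw [quotientHom_ker, hmap] at hcomap
  rw [← hcomap]
  rfl

/-- In a semisimple Lie algebra, a solvable subalgebra `P` of an ideal `I` which is normalized
by `I` vanishes. -/
theorem eq_bot_of_isSolvable_of_lie_mem [HasTrivialRadical K L] (I : LieIdeal K L)
    (P : LieSubalgebra K L) [IsSolvable P] (hPI : ∀ p ∈ P, p ∈ I)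
    (hP : ∀ x ∈ I, ∀ p ∈ P, ⁅x, p⁆ ∈ P) : P = ⊥ := by
  have hc := I.isCompl_killingCompl
  have hideal : ∀ x p : L, p ∈ P → ⁅x, p⁆ ∈ P := by
    intro x p hp
    obtain ⟨i, hi, c, hc', rfl⟩ := (LieSubmodule.mem_sup _ _ x).mp
      (hc.sup_eq_top ▸ LieSubmodule.mem_top x)
    have hzero : ⁅c, p⁆ = 0 := by
      rw [← LieSubmodule.mem_bot (R := K) (L := L), ← hc.inf_eq_bot]
      exact ⟨lie_mem_right K L I c p (hPI p hp), lie_mem_left K L _ c p hc'⟩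
    rw [add_lie, hzero, add_zero]
    exact hP i hi p hp
  obtain ⟨J, rfl⟩ := (LieSubalgebra.exists_lieIdeal_coe_eq_iff (K := P)).mpr hideal
  have : IsSolvable J := ‹_›
  rw [HasTrivialRadical.eq_bot_of_isSolvable J]
  rfl

/-- The radical of an ideal is its intersection with the radical of the ambient Lie algebra. -/
theorem mem_radical_iff_of_lie_mem (h : LieSubalgebra K L)
    (hh : ∀ x : L, ∀ y ∈ h, ⁅x, y⁆ ∈ h) (y : h) :
    y ∈ radical K h ↔ (y : L) ∈ radical K L := by
  obtain ⟨I, rfl⟩ := (LieSubalgebra.exists_lieIdeal_coe_eq_iff (K := h)).mpr hh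
  constructor
  · intro hy
    have hs := quotientHom_surjective (radical K L)
    let f : radical K I.toLieSubalgebra →ₗ⁅K⁆ L ⧸ radical K L :=
      (quotientHom (radical K L)).comp
        (I.toLieSubalgebra.incl.comp (radical K I.toLieSubalgebra).incl)
    have hf : f.range = ⊥ := by
      refine eq_bot_of_isSolvable_of_lie_mem (I.map (quotientHom (radical K L))) _ ?_ ?_
      · rintro _ ⟨z, rfl⟩
        exact LieIdeal.mem_map z.1.2
      · rintro x hx _ ⟨z, rfl⟩
        obtain ⟨i, rfl⟩ := LieIdeal.mem_map_of_surjective hs hx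
        exact ⟨⟨⁅(⟨i, i.2⟩ : I.toLieSubalgebra), z.1⁆, lie_mem_right K _ _ _ _ z.2⟩,
          LieHom.map_lie (quotientHom (radical K L)) _ _⟩
    have hmem : f ⟨y, hy⟩ ∈ f.range := ⟨_, rfl⟩
    rw [hf, LieSubalgebra.mem_bot] at hmem
    rw [← quotientHom_ker (radical K L), LieHom.mem_ker]
    exact hmem
  · intro hy
    have : IsSolvable (I.toLieSubalgebra.incl).ker := by
      rw [LieHom.ker_eq_bot _ |>.mpr Subtype.val_injective]
      infer_instance
    exact (LieIdeal.solvable_iff_le_radical K I.toLieSubalgebra _).mp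
      (isSolvable_comap I.toLieSubalgebra.incl (radical K L)) (LieIdeal.mem_comap.mpr hy)

end LieAlgebra

/-- If `h` is contained in an ideal `a` of `b`, `⁅h, g⁆ ⊆ b` and `⁅radical h, g⁆ ⊆ a`,
then `⁅h, g⁆ ⊆ a`, because `h` is spanned by its derived algebra and its radical. -/
theorem LieSubalgebra.IsIdealOf.lie_mem_of_radical {K : Type*} [Field K] [CharZero K]
    {g : Type*} [LieRing g] [LieAlgebra K g] [FiniteDimensional K g] {h a b : LieSubalgebra K g}
    (hab : a.IsIdealOf b) (ha : h ≤ a) (hb : ∀ y ∈ h, ∀ x : g, ⁅y, x⁆ ∈ b)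
    (hr : ∀ y ∈ LieAlgebra.radical K h, ∀ x : g, ⁅(y : g), x⁆ ∈ a)
    {y : g} (hy : y ∈ h) (x : g) : ⁅y, x⁆ ∈ a := by
  have hlie : ∀ u v : h, ⁅(u : g), ⁅(v : g), x⁆⁆ ∈ a := fun u v ↦ by
    rw [← lie_skew]
    exact neg_mem (hab.2 _ (hb v v.2 x) _ (ha u.2))
  obtain ⟨d, hd, r, hr', hdr⟩ := (LieSubmodule.mem_sup _ _ (⟨y, hy⟩ : h)).mp
    (LieAlgebra.derivedSeries_one_sup_radical K h ▸ LieSubmodule.mem_top _)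
  have hd' : ⁅(d : g), x⁆ ∈ a := by
    replace hd : d ∈ Submodule.span K {⁅u, v⁆ | (u : h) (v : h)} := by
      rw [← LieAlgebra.coe_derivedSeries_one_eq]
      exact hd
    clear hdr
    induction hd using Submodule.span_induction with
    | mem d hd =>
      obtain ⟨u, v, rfl⟩ := hd
      rw [LieSubalgebra.coe_bracket, lie_lie]
      exact sub_mem (hlie u v) (hlie v u)
    | zero => simp
    | add d e _ _ hd he => simpa [add_lie] using add_mem hd he
    | smul t d _ hd => simpa using a.smul_mem t hd
  have hsum : (d : g) + r = y := congrArg Subtype.val hdr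
  rw [← hsum, add_lie]
  exact add_mem hd' (hr r hr' x)

/-- For a subideal `h` of a finite-dimensional Lie algebra `g` in characteristic zero, with
radical `r_h` (viewed in `g`), the following are equivalent: (i) `h ⊴ g`; (ii) `r_h ⊴ g`;
(iii) `⁅r_h, g⁆ ⊆ h`. -/
theorem subideal_ideal_tfae {K : Type*} [Field K] [CharZero K] {g : Type*} [LieRing g]
    [LieAlgebra K g] [FiniteDimensional K g] (h : LieSubalgebra K g)
    (n : ℕ) (l : Fin (n + 1) → LieSubalgebra K g)
    (hl0 : l 0 = h) (hln : l (Fin.last n) = ⊤)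
    (hchain : ∀ i : Fin n, (l i.castSucc).IsIdealOf (l i.succ))
    (rh : Submodule K g)
    (hrh : rh = Submodule.map h.toSubmodule.subtype
      (LieSubmodule.toSubmodule (LieAlgebra.radical K h))) :
    List.TFAE [
      ∀ x : g, ∀ y ∈ h, ⁅x, y⁆ ∈ h,
      ∀ x : g, ∀ y ∈ rh, ⁅x, y⁆ ∈ rh,
      ∀ y ∈ rh, ∀ x : g, ⁅y, x⁆ ∈ h] := by
  subst hrh hl0
  have hmem (y : g) : y ∈ Submodule.map (l 0).toSubmodule.subtype
      (LieSubmodule.toSubmodule (LieAlgebra.radical K (l 0))) ↔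
      ∃ z ∈ LieAlgebra.radical K (l 0), (z : g) = y := Iff.rfl
  tfae_have 1 → 2 := by
    intro h1 x y hy
    obtain ⟨z, hz, rfl⟩ := (hmem y).mp hy
    have hiff := LieAlgebra.mem_radical_iff_of_lie_mem (l 0) h1
    exact (hmem _).mpr ⟨⟨⁅x, (z : g)⁆, h1 x z z.2⟩,
      (hiff _).mpr (lie_mem_right K g _ x z ((hiff z).mp hz)), rfl⟩
  tfae_have 2 → 3 := by
    intro h2 y hy x
    obtain ⟨z, -, hz⟩ := (hmem _).mp (h2 x y hy)
    rw [← lie_skew, ← hz]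
    exact neg_mem z.2
  tfae_have 3 → 1 := by
    intro h3
    have hle : ∀ i, l 0 ≤ l i := fun i ↦
      Fin.monotone_iff_le_succ.mpr (fun i ↦ (hchain i).1) (Fin.zero_le i)
    have hlie : ∀ i, ∀ y ∈ l 0, ∀ x : g, ⁅y, x⁆ ∈ l i := by
      intro i
      induction i using Fin.reverseInduction with
      | last => simp [hln]
      | cast i ih =>
        exact fun y hy x ↦ (hchain i).lie_mem_of_radical (hle _) ih
          (fun r hr x ↦ hle _ (h3 r ((hmem r).mpr ⟨r, hr, rfl⟩) x)) hy x
    intro x y hy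
    rw [← lie_skew]
    exact neg_mem (hlie 0 y hy x)
  tfae_finish
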